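/- arXiv:1805.09744 — 2 statements merged into one kernel-verified Lean document; each statement's English description precedes it below -/
import Mathlib

section
/- For x ≠ y ∈ 𝕋², the partial sums −∑_{p ∈ 2πℤ²∖{0}, |p| ≤ N} |p|^{−2}·e^{ip·(x−y)} converge as N → ∞ to a real limit G_x(y), and the function F(x,y) = G_x(y) − (1/2π)·ln d(x,y) is bounded on the set {(x,y) ∈ 𝕋²×𝕋² : x ≠ y}. -/
open MeasureTheory Filter Set

noncomputable section

/-- The torus metric on `[0,1) × [0,1)`:
`d(x,y) = min {‖x-y+(e₁,e₂)‖ : e₁,e₂ ∈ {-1,0,1}}` (Euclidean norm). -/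
def torusDist (x y : ℝ × ℝ) : ℝ :=
  sInf {r | ∃ e₁ e₂ : ℤ, |e₁| ≤ 1 ∧ |e₂| ≤ 1 ∧
    r = Real.sqrt ((x.1 - y.1 + e₁) ^ 2 + (x.2 - y.2 + e₂) ^ 2)}

/-- The unit torus, identified with `[0,1) × [0,1) ⊆ ℝ²`. -/
def Torus : Set (ℝ × ℝ) := Set.Ico (0 : ℝ) 1 ×ˢ Set.Ico (0 : ℝ) 1

open scoped Classical in
/-- The partial sum `-∑_{p ∈ 2πℤ² \ {0}, |p| ≤ N} |p|⁻² e^{i p·z}`, where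
`p = (2πk₁, 2πk₂)` ranges over the nonzero points of the lattice `2πℤ²` of
Euclidean norm at most `N`. -/
def latticePartialSum (N : ℕ) (z : ℝ × ℝ) : ℂ :=
  -∑ k ∈ (Finset.Icc (-(N : ℤ), -(N : ℤ)) ((N : ℤ), (N : ℤ))).filter
      (fun k : ℤ × ℤ => k ≠ (0, 0) ∧
        (2 * Real.pi * k.1) ^ 2 + (2 * Real.pi * k.2) ^ 2 ≤ (N : ℝ) ^ 2),
    (((1 : ℝ) / ((2 * Real.pi * k.1) ^ 2 + (2 * Real.pi * k.2) ^ 2) : ℝ) : ℂ) *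
      Complex.exp (Complex.I *
        (((2 * Real.pi * k.1) * z.1 + (2 * Real.pi * k.2) * z.2 : ℝ) : ℂ))

/-- The lattice points `k ∈ ℤ²` with `|k|² ≤ n`. -/
def latticeDisc (n : ℕ) : Finset (ℤ × ℤ) :=
  (Finset.Icc (-(n.sqrt : ℤ)) n.sqrt ×ˢ Finset.Icc (-(n.sqrt : ℤ)) n.sqrt).filter
    (fun k => k.1 ^ 2 + k.2 ^ 2 ≤ (n : ℤ))

theorem sq_le_natCast_iff_mem_Icc (a : ℤ) (n : ℕ) :
    a ^ 2 ≤ (n : ℤ) ↔ a ∈ Finset.Icc (-(n.sqrt : ℤ)) n.sqrt := by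
  rw [Finset.mem_Icc, ← abs_le, Int.abs_eq_natAbs, Nat.cast_le, Nat.le_sqrt', ← Int.natAbs_sq]
  norm_cast

theorem mem_latticeDisc {n : ℕ} {k : ℤ × ℤ} :
    k ∈ latticeDisc n ↔ k.1 ^ 2 + k.2 ^ 2 ≤ (n : ℤ) := by
  rw [latticeDisc, Finset.mem_filter, Finset.mem_product, ← sq_le_natCast_iff_mem_Icc,
    ← sq_le_natCast_iff_mem_Icc]
  refine ⟨fun h => h.2, fun h => ⟨⟨?_, ?_⟩, h⟩⟩ <;> nlinarith [sq_nonneg k.1, sq_nonneg k.2]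

/-- The phase `p · z` at `p = 2πk`. -/
def latticePhase (k : ℤ × ℤ) (z : ℝ × ℝ) : ℝ :=
  2 * Real.pi * k.1 * z.1 + 2 * Real.pi * k.2 * z.2

/-- The Dirichlet kernel of the disc `|k|² ≤ n`. -/
def discKernel (z : ℝ × ℝ) (n : ℕ) : ℝ :=
  ∑ k ∈ latticeDisc n, Real.cos (latticePhase k z)

/-- The sum of `|k|⁻² cos (2πk·z)` over `0 < |k|² ≤ n`; the term at the origin vanishes because
`1 / 0 = 0`. -/
def discSum (z : ℝ × ℝ) (n : ℕ) : ℝ :=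
  ∑ k ∈ latticeDisc n, 1 / ((k.1 : ℝ) ^ 2 + (k.2 : ℝ) ^ 2) * Real.cos (latticePhase k z)

theorem discSum_succ (z : ℝ × ℝ) (n : ℕ) :
    discSum z (n + 1) = discSum z n + (discKernel z (n + 1) - discKernel z n) / (n + 1) := by
  have hsub : latticeDisc n ⊆ latticeDisc (n + 1) := by
    intro k hk
    rw [mem_latticeDisc] at hk ⊢
    push_cast
    linarith
  rw [← sub_eq_iff_eq_add', discSum, discSum, discKernel, discKernel,
    ← Finset.sum_sdiff_eq_sub hsub, ← Finset.sum_sdiff_eq_sub hsub, Finset.sum_div]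
  refine Finset.sum_congr rfl fun k hk => ?_
  rw [Finset.mem_sdiff, mem_latticeDisc, mem_latticeDisc] at hk
  have h : k.1 ^ 2 + k.2 ^ 2 = (n : ℤ) + 1 := by
    push_cast at hk
    omega
  have h' : (k.1 : ℝ) ^ 2 + (k.2 : ℝ) ^ 2 = n + 1 := by exact_mod_cast h
  rw [h']
  ring

theorem sum_latticeDisc {M : Type*} [AddCommMonoid M] (n : ℕ) (f : ℤ × ℤ → M) :
    ∑ k ∈ latticeDisc n, f k = ∑ b ∈ Finset.Icc (-(n.sqrt : ℤ)) n.sqrt,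
      ∑ a ∈ Finset.Icc (-(((n : ℤ) - b ^ 2).toNat.sqrt : ℤ)) (((n : ℤ) - b ^ 2).toNat.sqrt),
        f (a, b) := by
  rw [latticeDisc, Finset.sum_filter, Finset.sum_product_right]
  refine Finset.sum_congr rfl fun b hb => ?_
  rw [← Finset.sum_filter]
  refine Finset.sum_congr ?_ fun _ _ => rfl
  ext a
  rw [← sq_le_natCast_iff_mem_Icc] at hb
  rw [Finset.mem_filter, ← sq_le_natCast_iff_mem_Icc, ← sq_le_natCast_iff_mem_Icc,
    Int.toNat_of_nonneg (by linarith)]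
  constructor
  · rintro ⟨-, h⟩
    linarith
  · intro h
    exact ⟨by nlinarith [sq_nonneg b], by linarith⟩

theorem two_mul_sin_mul_sum_cos (t φ : ℝ) (m : ℕ) :
    2 * Real.sin (Real.pi * t) * ∑ a ∈ Finset.Icc (-(m : ℤ)) m,
        Real.cos (2 * Real.pi * a * t + φ) =
      Real.sin ((2 * m + 1) * (Real.pi * t) + φ) + Real.sin ((2 * m + 1) * (Real.pi * t) - φ) := by
  induction m with
  | zero =>
    simp only [CharP.cast_eq_zero, neg_zero, Finset.Icc_self, Finset.sum_singleton, Int.cast_zero,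
      mul_zero, zero_mul, zero_add, one_mul, Real.sin_add, Real.sin_sub]
    ring
  | succ m ih =>
    have hset : Finset.Icc (-((m + 1 : ℕ) : ℤ)) (m + 1 : ℕ) =
        insert (-((m : ℤ) + 1)) (insert ((m : ℤ) + 1) (Finset.Icc (-(m : ℤ)) m)) := by
      ext a
      simp only [Finset.mem_insert, Finset.mem_Icc]
      push_cast
      omega
    rw [hset, Finset.sum_insert (by simp; omega), Finset.sum_insert (by simp), mul_add, mul_add, ih]
    push_cast
    have e1 : (2 * ((m : ℝ) + 1) + 1) * (Real.pi * t) =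
      2 * Real.pi * (m + 1) * t + Real.pi * t := by ring
    have e2 : (2 * (m : ℝ) + 1) * (Real.pi * t) =
      2 * Real.pi * (m + 1) * t - Real.pi * t := by ring
    have e3 : 2 * Real.pi * (-((m : ℝ) + 1)) * t = -(2 * Real.pi * (m + 1) * t) := by ring
    rw [e1, e2]
    simp only [e3, Real.sin_add, Real.sin_sub, Real.cos_add, Real.cos_sub, Real.cos_neg,
      Real.sin_neg]
    ring

theorem abs_sum_cos_le (t φ : ℝ) (m : ℕ) (ht : |t| ≤ 1 / 2) (h0 : t ≠ 0) :
    |∑ a ∈ Finset.Icc (-(m : ℤ)) m, Real.cos (2 * Real.pi * a * t + φ)| ≤ 1 / (2 * |t|) := by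
  have hpi := Real.pi_pos
  have hs : 2 * |t| ≤ |Real.sin (Real.pi * t)| := by
    have h := Real.mul_abs_le_abs_sin (x := Real.pi * t)
      (by rw [abs_mul, abs_of_pos hpi]; nlinarith)
    rw [abs_mul, abs_of_pos hpi] at h
    calc 2 * |t| = 2 / Real.pi * (Real.pi * |t|) := by field_simp
      _ ≤ _ := h
  have key := congrArg abs (two_mul_sin_mul_sum_cos t φ m)
  rw [abs_mul, abs_mul, abs_two] at key
  have h2 := abs_add_le (Real.sin ((2 * m + 1) * (Real.pi * t) + φ))
    (Real.sin ((2 * m + 1) * (Real.pi * t) - φ))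
  have h3 := Real.abs_sin_le_one ((2 * m + 1) * (Real.pi * t) + φ)
  have h4 := Real.abs_sin_le_one ((2 * m + 1) * (Real.pi * t) - φ)
  have ht0 : 0 < |t| := abs_pos.2 h0
  rw [le_div_iff₀ (by positivity)]
  nlinarith [abs_nonneg (∑ a ∈ Finset.Icc (-(m : ℤ)) m, Real.cos (2 * Real.pi * a * t + φ))]

theorem card_Icc_neg_natCast (s : ℕ) : ((Finset.Icc (-(s : ℤ)) s).card : ℝ) = 2 * s + 1 := by
  rw [Int.card_Icc, show ((s : ℤ) + 1 - -(s : ℤ)).toNat = 2 * s + 1 by omega]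
  push_cast
  ring

theorem abs_discKernel_le_fst (z : ℝ × ℝ) (ht : |z.1| ≤ 1 / 2) (h0 : z.1 ≠ 0) {n : ℕ}
    (hn : 1 ≤ n) : |discKernel z n| ≤ 3 / (2 * |z.1|) * √n := by
  rw [discKernel, sum_latticeDisc]
  refine (Finset.abs_sum_le_sum_abs _ _).trans ?_
  refine (Finset.sum_le_card_nsmul _ _ (1 / (2 * |z.1|)) fun b _ => ?_).trans ?_
  · simpa only [latticePhase] using abs_sum_cos_le z.1 (2 * Real.pi * b * z.2) _ ht h0
  · rw [nsmul_eq_mul, card_Icc_neg_natCast]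
    have h1 : (1 : ℝ) ≤ √n := Real.one_le_sqrt.2 (by exact_mod_cast hn)
    have h2 : (n.sqrt : ℝ) ≤ √n := Real.nat_sqrt_le_real_sqrt
    have h3 : 0 ≤ 1 / (2 * |z.1|) := by positivity
    calc (2 * (n.sqrt : ℝ) + 1) * (1 / (2 * |z.1|)) ≤ (3 * √n) * (1 / (2 * |z.1|)) := by
          gcongr
          linarith
      _ = _ := by ring

theorem discKernel_swap (z : ℝ × ℝ) (n : ℕ) : discKernel z.swap n = discKernel z n := by
  refine Finset.sum_equiv (Equiv.prodComm ℤ ℤ) (fun k => ?_) fun k _ => ?_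
  · simp [mem_latticeDisc, add_comm]
  · simp [latticePhase, add_comm]

theorem abs_discKernel_le (z : ℝ × ℝ) (h1 : |z.1| ≤ 1 / 2) (h2 : |z.2| ≤ 1 / 2)
    (hz : z.1 ^ 2 + z.2 ^ 2 ≠ 0) {n : ℕ} (hn : 1 ≤ n) :
    |discKernel z n| ≤ 3 / √(z.1 ^ 2 + z.2 ^ 2) * √n := by
  wlog h : |z.2| ≤ |z.1| generalizing z
  · have := this z.swap h2 h1 (by simpa [add_comm] using hz) (le_of_not_ge h)
    rw [discKernel_swap] at this
    simpa [add_comm] using this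
  have h0 : z.1 ≠ 0 := by
    intro h0
    rw [h0, abs_zero, abs_nonpos_iff] at h
    simp [h, h0] at hz
  refine (abs_discKernel_le_fst z h1 h0 hn).trans ?_
  have : √(z.1 ^ 2 + z.2 ^ 2) ≤ 2 * |z.1| := by
    rw [Real.sqrt_le_iff]
    refine ⟨by positivity, ?_⟩
    nlinarith [sq_abs z.1, sq_abs z.2, abs_nonneg z.1, abs_nonneg z.2]
  have hp : 0 < √(z.1 ^ 2 + z.2 ^ 2) := Real.sqrt_pos.2 (by positivity)
  gcongr

/-- Summation by parts: if `D n = O(√n)`, then the series with terms `(D n - D (n - 1)) / n`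
converges with an explicit tail bound. -/
theorem exists_tendsto_of_sub_div {D T : ℕ → ℝ} {K : ℝ} (hK : 0 ≤ K)
    (hD : ∀ n, 1 ≤ n → |D n| ≤ K * √n)
    (hT : ∀ n : ℕ, T (n + 1) = T n + (D (n + 1) - D n) / (n + 1)) :
    ∃ L, Tendsto T atTop (nhds L) ∧ ∀ m : ℕ, 1 ≤ m → |L - T m| ≤ 3 * K / √(m + 1) := by
  set U : ℕ → ℝ := fun n => T n - D n / (n + 1) with hU
  have hstep : ∀ n : ℕ, |U (n + 1) - U n| ≤
      2 * K / √(n + 1) - 2 * K / √((n + 1 : ℕ) + 1) := by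
    intro n
    have e : U (n + 1) - U n = D (n + 1) / ((n + 1) * (n + 2)) := by
      simp only [hU, hT]
      push_cast
      field_simp
      ring
    rw [e, abs_div, abs_of_pos (by positivity : (0 : ℝ) < (n + 1) * (n + 2))]
    have hd := hD (n + 1) (by omega)
    push_cast at hd ⊢
    rw [show (n : ℝ) + 1 + 1 = n + 2 by ring]
    set p := √((n : ℝ) + 1)
    set q := √((n : ℝ) + 2)
    have hp : 0 < p := Real.sqrt_pos.2 (by positivity)
    have hp2 : p ^ 2 = n + 1 := Real.sq_sqrt (by positivity)
    have hq2 : q ^ 2 = n + 2 := Real.sq_sqrt (by positivity)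
    have hpq : p ≤ q := Real.sqrt_le_sqrt (by linarith)
    have hq : 0 < q := hp.trans_le hpq
    rw [← hp2, ← hq2]
    have hdiff : 2 * K / p - 2 * K / q = 2 * K * ((q ^ 2 - p ^ 2) / (p * q * (p + q))) := by
      field_simp
      ring
    rw [hdiff, hp2, hq2, show (n : ℝ) + 2 - (n + 1) = 1 by ring, ← hp2, ← hq2]
    calc |D (n + 1)| / (p ^ 2 * q ^ 2) ≤ K * p / (p ^ 2 * q ^ 2) := by gcongr
      _ = 2 * K * (1 / (p * q * (q + q))) := by field_simp; ring
      _ ≤ _ := by gcongr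
  have hdist : ∀ m n : ℕ, m ≤ n → |U n - U m| ≤
      2 * K / √(m + 1) - 2 * K / √(n + 1) := by
    intro m n hmn
    induction n, hmn using Nat.le_induction with
    | base => simp
    | succ n hmn ih =>
      have := abs_add_le (U (n + 1) - U n) (U n - U m)
      rw [sub_add_sub_cancel] at this
      linarith [hstep n]
  have hdist' : ∀ m n : ℕ, m ≤ n → |U n - U m| ≤ 2 * K / √(m + 1) := by
    intro m n hmn
    have : 0 ≤ 2 * K / √((n : ℝ) + 1) := by positivity
    linarith [hdist m n hmn]
  have hsqrt : Tendsto (fun m : ℕ => √((m : ℝ) + 1)) atTop atTop :=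
    Real.tendsto_sqrt_atTop.comp
      (tendsto_atTop_add_const_right _ _ tendsto_natCast_atTop_atTop)
  have hcauchy : CauchySeq U := by
    refine cauchySeq_of_le_tendsto_0' (fun m : ℕ => 2 * K / √((m : ℝ) + 1)) (fun m n hmn => ?_)
      (hsqrt.const_div_atTop _)
    rw [dist_comm, Real.dist_eq]
    exact hdist' m n hmn
  obtain ⟨L, hL⟩ := cauchySeq_tendsto_of_complete hcauchy
  have hdiv : ∀ m : ℕ, 1 ≤ m → |D m / (m + 1)| ≤ K / √(m + 1) := by
    intro m hm
    rw [abs_div, abs_of_pos (by positivity : (0 : ℝ) < m + 1), div_le_div_iff₀ (by positivity)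
      (Real.sqrt_pos.2 (by positivity))]
    have hp2 : √((m : ℝ) + 1) ^ 2 = m + 1 := Real.sq_sqrt (by positivity)
    have hle : √(m : ℝ) ≤ √((m : ℝ) + 1) := Real.sqrt_le_sqrt (by linarith)
    calc |D m| * √((m : ℝ) + 1) ≤ (K * √((m : ℝ) + 1)) * √((m : ℝ) + 1) := by
          gcongr
          exact (hD m hm).trans (by gcongr)
      _ = K * √((m : ℝ) + 1) ^ 2 := by ring
      _ = _ := by rw [hp2]
  refine ⟨L, ?_, fun m hm => ?_⟩
  · have h0 : Tendsto (fun n : ℕ => D n / ((n : ℝ) + 1)) atTop (nhds 0) := by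
      refine squeeze_zero_norm' ?_ (hsqrt.const_div_atTop K)
      filter_upwards [eventually_ge_atTop 1] with n hn using hdiv n hn
    have := hL.add h0
    simpa [hU] using this
  · have h1 : |L - U m| ≤ 2 * K / √(m + 1) := by
      refine le_of_tendsto (hL.sub_const (U m)).abs ?_
      filter_upwards [eventually_ge_atTop m] with n hn using hdist' m n hn
    have h2 := abs_sub (L - U m) (D m / (m + 1))
    have e : L - U m - D m / (m + 1) = L - T m := by simp only [hU]; ring
    rw [e] at h2
    have h3 := hdiv m hm
    have e2 : 3 * K / √((m : ℝ) + 1) = 2 * K / √(m + 1) + K / √(m + 1) := by ring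
    rw [e2]
    linarith

theorem arctan_sub_arctan_bounds {u v : ℝ} (hu : 0 ≤ u) (huv : u < v) :
    (v - u) / (1 + v ^ 2) ≤ Real.arctan v - Real.arctan u ∧
      Real.arctan v - Real.arctan u ≤ (v - u) / (1 + u ^ 2) := by
  obtain ⟨c, ⟨hc1, hc2⟩, hc⟩ := exists_hasDerivAt_eq_slope Real.arctan (fun x => 1 / (1 + x ^ 2)) huv
    Real.continuous_arctan.continuousOn fun x _ => Real.hasDerivAt_arctan x
  have hvu : 0 < v - u := sub_pos.2 huv
  have e : Real.arctan v - Real.arctan u = (v - u) / (1 + c ^ 2) := by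
    rw [eq_div_iff hvu.ne'] at hc
    rw [← hc]
    ring
  have hc0 : 0 ≤ c := hu.trans hc1.le
  rw [e]
  constructor <;> gcongr

theorem sum_inv_sq_add_sq_le {a : ℝ} (ha : 0 < a) (s : ℕ) :
    ∑ b ∈ Finset.range s, 1 / (a ^ 2 + ((b : ℝ) + 1) ^ 2) ≤ Real.arctan (s / a) / a := by
  induction s with
  | zero => simp
  | succ s ih =>
    have h := (arctan_sub_arctan_bounds (u := s / a) (v := (s + 1) / a) (by positivity)
      (by gcongr; linarith)).1
    have e : ((s + 1) / a - s / a) / (1 + ((s + 1) / a) ^ 2) =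
        a * (1 / (a ^ 2 + ((s : ℝ) + 1) ^ 2)) := by
      field_simp
      ring
    rw [e] at h
    rw [Finset.sum_range_succ, le_div_iff₀ ha] at *
    push_cast
    linarith

theorem le_sum_inv_sq_add_sq {a : ℝ} (ha : 0 < a) (s : ℕ) :
    Real.arctan (s / a) / a ≤ ∑ b ∈ Finset.range s, 1 / (a ^ 2 + (b : ℝ) ^ 2) := by
  induction s with
  | zero => simp
  | succ s ih =>
    have h := (arctan_sub_arctan_bounds (u := s / a) (v := (s + 1) / a) (by positivity)
      (by gcongr; linarith)).2
    have e : ((s + 1) / a - s / a) / (1 + (s / a) ^ 2) =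
        a * (1 / (a ^ 2 + (s : ℝ) ^ 2)) := by
      field_simp
      ring
    rw [e] at h
    rw [Finset.sum_range_succ, div_le_iff₀ ha] at *
    push_cast
    linarith

theorem abs_two_mul_sum_sub_pi_div_le {a : ℝ} (ha : 0 < a) {s : ℕ} (hs : 1 ≤ s) :
    |(1 / a ^ 2 + 2 * ∑ b ∈ Finset.range s, 1 / (a ^ 2 + ((b : ℝ) + 1) ^ 2)) - Real.pi / a| ≤
      1 / a ^ 2 + 2 / s := by
  have hs0 : (0 : ℝ) < s := by exact_mod_cast hs
  have h1 := sum_inv_sq_add_sq_le ha s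
  have h2 := le_sum_inv_sq_add_sq ha s
  have h3 : Real.arctan (s / a) / a ≤ Real.pi / 2 / a := by
    gcongr
    exact (Real.arctan_lt_pi_div_two _).le
  have h4 : Real.pi / 2 / a - 1 / s ≤ Real.arctan (s / a) / a := by
    have e : Real.arctan (s / a) = Real.pi / 2 - Real.arctan (a / s) := by
      rw [← Real.arctan_inv_of_pos (by positivity), inv_div]
    have h := (arctan_sub_arctan_bounds le_rfl (show 0 < a / s by positivity)).2
    simp only [Real.arctan_zero, sub_zero] at h
    rw [e, sub_div]
    have : Real.arctan (a / s) / a ≤ a / s / a := by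
      gcongr
      simpa using h
    rw [show a / s / a = 1 / (s : ℝ) by field_simp] at this
    linarith
  have h5 : ∑ b ∈ Finset.range s, 1 / (a ^ 2 + (b : ℝ) ^ 2) ≤
      1 / a ^ 2 + ∑ b ∈ Finset.range s, 1 / (a ^ 2 + ((b : ℝ) + 1) ^ 2) := by
    have h6 := Finset.sum_range_succ (fun b : ℕ => 1 / (a ^ 2 + (b : ℝ) ^ 2)) s
    rw [Finset.sum_range_succ'] at h6
    push_cast at h6
    have h7 : 0 ≤ 1 / (a ^ 2 + (s : ℝ) ^ 2) := by positivity
    simp only [ne_eq, OfNat.ofNat_ne_zero, not_false_eq_true, zero_pow, add_zero] at h6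
    linarith
  have e1 : Real.pi / a = 2 * (Real.pi / 2 / a) := by ring
  have e2 : 2 / (s : ℝ) = 2 * (1 / s) := by ring
  have h8 : 0 ≤ 1 / (s : ℝ) := by positivity
  have h9 : 0 ≤ 1 / a ^ 2 := by positivity
  rw [abs_le, e1, e2]
  constructor <;> linarith

theorem sum_Icc_neg_of_even {f : ℤ → ℝ} (hf : Function.Even f) (s : ℕ) :
    ∑ a ∈ Finset.Icc (-(s : ℤ)) s, f a = f 0 + 2 * ∑ i ∈ Finset.range s, f ((i : ℤ) + 1) := by
  rw [Finset.sum_Icc_of_even_eq_range hf, Finset.sum_range_succ']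
  push_cast
  rw [nsmul_eq_mul]
  push_cast
  ring

theorem sum_range_inv_sq_le (s : ℕ) : ∑ i ∈ Finset.range s, 1 / ((i : ℝ) + 1) ^ 2 ≤ 2 := by
  have key : ∀ s : ℕ, ∑ i ∈ Finset.range (s + 1), 1 / ((i : ℝ) + 1) ^ 2 ≤ 2 - 1 / ((s : ℝ) + 1) := by
    intro s
    induction s with
    | zero => norm_num
    | succ s ih =>
      rw [Finset.sum_range_succ]
      push_cast
      have h : 1 / ((s : ℝ) + 1 + 1) ^ 2 ≤ 1 / (s + 1) - 1 / (s + 1 + 1) := by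
        rw [div_sub_div _ _ (by positivity) (by positivity)]
        refine (div_le_div_iff₀ (by positivity) (by positivity)).2 ?_
        nlinarith [(Nat.cast_nonneg s : (0 : ℝ) ≤ s)]
      linarith
  have h1 := key s
  rw [Finset.sum_range_succ] at h1
  have h2 : 0 ≤ 1 / ((s : ℝ) + 1) := by positivity
  have h3 : 0 ≤ 1 / ((s : ℝ) + 1) ^ 2 := by positivity
  linarith

/-- The sum of `|k|⁻²` over the square `|k₁|, |k₂| ≤ s` is `2π log s + O(1)`. -/
theorem abs_square_sum_sub_log_le {s : ℕ} (hs : 1 ≤ s) :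
    |∑ k ∈ Finset.Icc (-(s : ℤ)) s ×ˢ Finset.Icc (-(s : ℤ)) s,
        1 / ((k.1 : ℝ) ^ 2 + (k.2 : ℝ) ^ 2) - 2 * Real.pi * Real.log s| ≤ 20 := by
  have hs0 : (0 : ℝ) < s := by exact_mod_cast hs
  have hpi := Real.pi_pos
  have hpi4 := Real.pi_le_four
  set R : ℤ → ℝ := fun a => ∑ b ∈ Finset.Icc (-(s : ℤ)) s, 1 / ((a : ℝ) ^ 2 + (b : ℝ) ^ 2) with hR
  have hrow : ∀ a : ℤ, R a = 1 / (a : ℝ) ^ 2 +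
      2 * ∑ b ∈ Finset.range s, 1 / ((a : ℝ) ^ 2 + ((b : ℝ) + 1) ^ 2) := by
    intro a
    have := sum_Icc_neg_of_even (f := fun b : ℤ => 1 / ((a : ℝ) ^ 2 + (b : ℝ) ^ 2))
      (fun b => by simp) s
    simpa [hR] using this
  have hReven : Function.Even R := fun a => by simp [hR]
  rw [Finset.sum_product]
  change |∑ a ∈ Finset.Icc (-(s : ℤ)) s, R a - _| ≤ 20
  rw [sum_Icc_neg_of_even hReven]
  have hR0 : |R 0| ≤ 4 := by
    rw [hrow 0]
    have h := sum_range_inv_sq_le s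
    have h' : 0 ≤ ∑ i ∈ Finset.range s, 1 / ((i : ℝ) + 1) ^ 2 :=
      Finset.sum_nonneg fun i _ => by positivity
    simp only [Int.cast_zero, ne_eq, OfNat.ofNat_ne_zero, not_false_eq_true, zero_pow, div_zero,
      zero_add]
    rw [abs_le]
    constructor <;> linarith
  have hsum : |∑ i ∈ Finset.range s, R ((i : ℤ) + 1) -
      ∑ i ∈ Finset.range s, Real.pi / ((i : ℝ) + 1)| ≤ 4 := by
    rw [← Finset.sum_sub_distrib]
    refine (Finset.abs_sum_le_sum_abs _ _).trans ?_
    calc _ ≤ ∑ i ∈ Finset.range s, (1 / ((i : ℝ) + 1) ^ 2 + 2 / s) := by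
          refine Finset.sum_le_sum fun i _ => ?_
          rw [hrow]
          push_cast
          exact abs_two_mul_sum_sub_pi_div_le (by positivity) hs
      _ ≤ 2 + 2 := by
          rw [Finset.sum_add_distrib, Finset.sum_const, Finset.card_range, nsmul_eq_mul,
            mul_div_cancel₀ _ hs0.ne']
          linarith [sum_range_inv_sq_le s]
      _ = 4 := by norm_num
  have hharm : |∑ i ∈ Finset.range s, Real.pi / ((i : ℝ) + 1) - Real.pi * Real.log s| ≤ 4 := by
    have e : ∑ i ∈ Finset.range s, Real.pi / ((i : ℝ) + 1) = Real.pi * (harmonic s : ℝ) := by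
      rw [harmonic]
      push_cast
      rw [Finset.mul_sum]
      exact Finset.sum_congr rfl fun i _ => by rw [div_eq_mul_inv]
    have h1 := log_add_one_le_harmonic s
    have h2 := harmonic_le_one_add_log s
    have h3 : Real.log s ≤ Real.log (s + 1 : ℕ) := Real.log_le_log hs0 (by push_cast; linarith)
    rw [e, ← mul_sub, abs_mul, abs_of_pos hpi, abs_of_nonneg (by linarith)]
    nlinarith
  rw [abs_le] at *
  constructor <;> linarith

theorem card_square_le {n : ℕ} (hn : 1 ≤ n) :
    ((Finset.Icc (-(n.sqrt : ℤ)) n.sqrt ×ˢ Finset.Icc (-(n.sqrt : ℤ)) n.sqrt).card : ℝ) ≤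
      9 * n := by
  have hs : (1 : ℝ) ≤ n.sqrt := by exact_mod_cast Nat.le_sqrt'.2 (by simpa using hn)
  have hle : (n.sqrt : ℝ) ^ 2 ≤ n := by exact_mod_cast Nat.sqrt_le' n
  rw [Finset.card_product, Nat.cast_mul, card_Icc_neg_natCast]
  nlinarith

theorem card_latticeDisc_le {n : ℕ} (hn : 1 ≤ n) : ((latticeDisc n).card : ℝ) ≤ 9 * n :=
  le_trans (by exact_mod_cast Finset.card_filter_le _ _) (card_square_le hn)

/-- The sum of `|k|⁻²` over `0 < |k|² ≤ n` is `π log n + O(1)`. -/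
theorem abs_discSum_zero_sub_log_le {n : ℕ} (hn : 1 ≤ n) :
    |discSum 0 n - Real.pi * Real.log n| ≤ 40 := by
  have hpi := Real.pi_pos
  have hpi4 := Real.pi_le_four
  have hs : 1 ≤ n.sqrt := Nat.le_sqrt'.2 (by simpa using hn)
  have hs1 : (1 : ℝ) ≤ n.sqrt := by exact_mod_cast hs
  have hn1 : (1 : ℝ) ≤ n := by exact_mod_cast hn
  have hle : ((n.sqrt : ℝ)) ^ 2 ≤ n := by exact_mod_cast Nat.sqrt_le' n
  have hlt : (n : ℝ) ≤ ((n.sqrt : ℝ) + 1) ^ 2 := by exact_mod_cast (Nat.lt_succ_sqrt' n).le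
  have hsq := abs_square_sum_sub_log_le hs
  set Q := Finset.Icc (-(n.sqrt : ℤ)) n.sqrt ×ˢ Finset.Icc (-(n.sqrt : ℤ)) n.sqrt with hQ
  have hdisc : discSum 0 n = ∑ k ∈ latticeDisc n, 1 / ((k.1 : ℝ) ^ 2 + (k.2 : ℝ) ^ 2) := by
    simp [discSum, latticePhase]
  have hsub : latticeDisc n ⊆ Q := Finset.filter_subset _ _
  have hcard : (Q.card : ℝ) ≤ 9 * n := card_square_le hn
  have hdiff := Finset.sum_sdiff_eq_sub (f := fun k : ℤ × ℤ => 1 / ((k.1 : ℝ) ^ 2 + (k.2 : ℝ) ^ 2))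
    hsub
  rw [← hdisc] at hdiff
  have h0 : 0 ≤ ∑ k ∈ Q \ latticeDisc n, 1 / ((k.1 : ℝ) ^ 2 + (k.2 : ℝ) ^ 2) :=
    Finset.sum_nonneg fun k _ => by positivity
  have h9 : ∑ k ∈ Q \ latticeDisc n, 1 / ((k.1 : ℝ) ^ 2 + (k.2 : ℝ) ^ 2) ≤ 9 := by
    calc _ ≤ (Q \ latticeDisc n).card • (1 / (n : ℝ)) := by
          refine Finset.sum_le_card_nsmul _ _ _ fun k hk => ?_
          rw [Finset.mem_sdiff, mem_latticeDisc, not_le] at hk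
          have : (n : ℝ) ≤ (k.1 : ℝ) ^ 2 + (k.2 : ℝ) ^ 2 := by exact_mod_cast hk.2.le
          gcongr
      _ ≤ 9 * n * (1 / (n : ℝ)) := by
          rw [nsmul_eq_mul]
          gcongr
          refine le_trans ?_ hcard
          exact_mod_cast Finset.card_le_card Finset.sdiff_subset
      _ = 9 := by field_simp
  have hlog1 : 2 * Real.log n.sqrt ≤ Real.log n := by
    have := Real.log_le_log (by positivity) hle
    rwa [Real.log_pow, Nat.cast_ofNat] at this
  have hlog2 : Real.log n ≤ 2 * Real.log n.sqrt + 2 := by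
    have h := Real.log_le_log (by positivity)
      (hlt.trans (show ((n.sqrt : ℝ) + 1) ^ 2 ≤ (2 * n.sqrt) ^ 2 by gcongr; linarith))
    rw [Real.log_pow, Real.log_mul (by norm_num) (by positivity), Nat.cast_ofNat] at h
    linarith [Real.log_two_lt_d9]
  have hl : |2 * Real.pi * Real.log n.sqrt - Real.pi * Real.log n| ≤ 8 := by
    rw [abs_le]
    constructor <;> nlinarith
  rw [abs_le] at *
  constructor <;> linarith

theorem abs_discSum_sub_discSum_zero_le (z : ℝ × ℝ) {n : ℕ} (hn : 1 ≤ n) :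
    |discSum z n - discSum 0 n| ≤ 18 * Real.pi ^ 2 * (z.1 ^ 2 + z.2 ^ 2) * n := by
  rw [discSum, discSum, ← Finset.sum_sub_distrib]
  refine (Finset.abs_sum_le_sum_abs _ _).trans ?_
  calc _ ≤ (latticeDisc n).card • (2 * Real.pi ^ 2 * (z.1 ^ 2 + z.2 ^ 2)) := by
        refine Finset.sum_le_card_nsmul _ _ _ fun k _ => ?_
        have h0 : Real.cos (latticePhase k 0) = 1 := by simp [latticePhase]
        rw [h0, ← mul_sub, abs_mul, abs_of_nonneg (by positivity), abs_sub_comm,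
          abs_of_nonneg (by linarith [Real.cos_le_one (latticePhase k z)])]
        rcases (by positivity : 0 ≤ (k.1 : ℝ) ^ 2 + (k.2 : ℝ) ^ 2).eq_or_lt with h | h
        · rw [← h]
          simp only [div_zero, zero_mul]
          positivity
        · rw [one_div, inv_mul_le_iff₀ h]
          have h1 := Real.one_sub_sq_div_two_le_cos (x := latticePhase k z)
          have h2 : latticePhase k z ^ 2 ≤
              4 * Real.pi ^ 2 * (((k.1 : ℝ) ^ 2 + (k.2 : ℝ) ^ 2) * (z.1 ^ 2 + z.2 ^ 2)) := by
            have e : latticePhase k z ^ 2 = 4 * Real.pi ^ 2 *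
                (((k.1 : ℝ) ^ 2 + (k.2 : ℝ) ^ 2) * (z.1 ^ 2 + z.2 ^ 2) -
                  (k.1 * z.2 - k.2 * z.1) ^ 2) := by
              rw [latticePhase]
              ring
            rw [e]
            gcongr
            linarith [sq_nonneg (k.1 * z.2 - k.2 * z.1)]
          linarith
    _ ≤ 9 * n * (2 * Real.pi ^ 2 * (z.1 ^ 2 + z.2 ^ 2)) := by
        rw [nsmul_eq_mul]
        gcongr
        exact card_latticeDisc_le hn
    _ = _ := by ring

theorem discSum_add_intCast (z : ℝ × ℝ) (e₁ e₂ : ℤ) (n : ℕ) :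
    discSum (z.1 + e₁, z.2 + e₂) n = discSum z n := by
  refine Finset.sum_congr rfl fun k _ => ?_
  have h : latticePhase k (z.1 + e₁, z.2 + e₂) =
      latticePhase k z + (k.1 * e₁ + k.2 * e₂ : ℤ) * (2 * Real.pi) := by
    simp only [latticePhase]
    push_cast
    ring
  rw [h, Real.cos_add_int_mul_two_pi]

theorem sum_sin_latticePhase_eq_zero (z : ℝ × ℝ) (n : ℕ) :
    ∑ k ∈ latticeDisc n, 1 / ((k.1 : ℝ) ^ 2 + (k.2 : ℝ) ^ 2) * Real.sin (latticePhase k z) = 0 := by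
  have h : ∑ k ∈ latticeDisc n,
        1 / ((k.1 : ℝ) ^ 2 + (k.2 : ℝ) ^ 2) * Real.sin (latticePhase k z) =
      ∑ k ∈ latticeDisc n,
        -(1 / ((k.1 : ℝ) ^ 2 + (k.2 : ℝ) ^ 2) * Real.sin (latticePhase k z)) := by
    refine Finset.sum_equiv (Equiv.neg (ℤ × ℤ)) (fun k => ?_) fun k _ => ?_
    · simp [mem_latticeDisc]
    · have hp : latticePhase (-k) z = -latticePhase k z := by
        simp only [latticePhase, Prod.fst_neg, Prod.snd_neg]
        push_cast
        ring
      simp [hp]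
  rw [Finset.sum_neg_distrib] at h
  linarith

theorem latticePartialSum_eq (N : ℕ) (z : ℝ × ℝ) :
    latticePartialSum N z =
      ((-(1 / (4 * Real.pi ^ 2)) * discSum z ⌊(N : ℝ) ^ 2 / (4 * Real.pi ^ 2)⌋₊ : ℝ) : ℂ) := by
  classical
  have hpi := Real.pi_pos
  have hpi3 := Real.pi_gt_three
  set n := ⌊(N : ℝ) ^ 2 / (4 * Real.pi ^ 2)⌋₊ with hn
  have hiff : ∀ k : ℤ × ℤ, (2 * Real.pi * k.1) ^ 2 + (2 * Real.pi * k.2) ^ 2 ≤ (N : ℝ) ^ 2 ↔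
      k ∈ latticeDisc n := by
    intro k
    have hk : 0 ≤ k.1 ^ 2 + k.2 ^ 2 := by positivity
    rw [mem_latticeDisc, ← Int.toNat_of_nonneg hk, Nat.cast_le, hn, Nat.le_floor_iff (by positivity),
      le_div_iff₀ (by positivity)]
    have e : (((k.1 ^ 2 + k.2 ^ 2).toNat : ℕ) : ℝ) = (k.1 : ℝ) ^ 2 + (k.2 : ℝ) ^ 2 := by
      have : (((k.1 ^ 2 + k.2 ^ 2).toNat : ℤ) : ℝ) = ((k.1 ^ 2 + k.2 ^ 2 : ℤ) : ℝ) := by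
        rw [Int.toNat_of_nonneg hk]
      push_cast at this
      exact_mod_cast this
    rw [e]
    ring_nf
  have hbox : ∀ a : ℤ, (2 * Real.pi * a) ^ 2 ≤ (N : ℝ) ^ 2 → -(N : ℤ) ≤ a ∧ a ≤ N := by
    intro a ha
    rw [← abs_le]
    have h1 := abs_le_of_sq_le_sq ha (Nat.cast_nonneg N)
    have h2 : |(a : ℝ)| ≤ N := by
      rw [abs_mul, abs_of_pos (by positivity)] at h1
      nlinarith [abs_nonneg (a : ℝ)]
    exact_mod_cast h2
  have hset : (Finset.Icc (-(N : ℤ), -(N : ℤ)) ((N : ℤ), (N : ℤ))).filter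
      (fun k : ℤ × ℤ => k ≠ (0, 0) ∧
        (2 * Real.pi * k.1) ^ 2 + (2 * Real.pi * k.2) ^ 2 ≤ (N : ℝ) ^ 2) =
      (latticeDisc n).erase (0, 0) := by
    ext k
    rw [Finset.mem_filter, Finset.mem_erase, ← hiff, Finset.mem_Icc]
    refine ⟨fun h => h.2, fun h => ⟨?_, h⟩⟩
    have h1 := hbox k.1 (by nlinarith [h.2, sq_nonneg (2 * Real.pi * k.2)])
    have h2 := hbox k.2 (by nlinarith [h.2, sq_nonneg (2 * Real.pi * k.1)])
    exact ⟨⟨h1.1, h2.1⟩, ⟨h1.2, h2.2⟩⟩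
  have hterm : ∀ k : ℤ × ℤ,
      (((1 : ℝ) / ((2 * Real.pi * k.1) ^ 2 + (2 * Real.pi * k.2) ^ 2) : ℝ) : ℂ) *
        Complex.exp (Complex.I *
          (((2 * Real.pi * k.1) * z.1 + (2 * Real.pi * k.2) * z.2 : ℝ) : ℂ)) =
      ((1 / (4 * Real.pi ^ 2) : ℝ) : ℂ) *
        (((1 / ((k.1 : ℝ) ^ 2 + (k.2 : ℝ) ^ 2) * Real.cos (latticePhase k z) : ℝ) : ℂ) +
          ((1 / ((k.1 : ℝ) ^ 2 + (k.2 : ℝ) ^ 2) * Real.sin (latticePhase k z) : ℝ) : ℂ) *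
            Complex.I) := by
    intro k
    change _ * Complex.exp (Complex.I * ((latticePhase k z : ℝ) : ℂ)) = _
    have e : (1 : ℝ) / ((2 * Real.pi * k.1) ^ 2 + (2 * Real.pi * k.2) ^ 2) =
        1 / (4 * Real.pi ^ 2) * (1 / ((k.1 : ℝ) ^ 2 + (k.2 : ℝ) ^ 2)) := by
      rw [one_div_mul_one_div]
      ring_nf
    rw [e, mul_comm Complex.I, Complex.exp_mul_I, ← Complex.ofReal_cos, ← Complex.ofReal_sin]
    push_cast
    ring
  have hz : latticePartialSum N z = -∑ k ∈ (latticeDisc n).erase (0, 0),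
      (((1 : ℝ) / ((2 * Real.pi * k.1) ^ 2 + (2 * Real.pi * k.2) ^ 2) : ℝ) : ℂ) *
        Complex.exp (Complex.I *
          (((2 * Real.pi * k.1) * z.1 + (2 * Real.pi * k.2) * z.2 : ℝ) : ℂ)) := by
    rw [← hset, latticePartialSum]
  rw [hz, Finset.sum_erase _ (by simp), Finset.sum_congr rfl fun k _ => hterm k, ← Finset.mul_sum,
    Finset.sum_add_distrib, ← Finset.sum_mul, ← Complex.ofReal_sum, ← Complex.ofReal_sum,
    sum_sin_latticePhase_eq_zero, ← discSum]
  push_cast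
  ring

theorem abs_le_abs_add_intCast {t : ℝ} (ht : |t| ≤ 1 / 2) (n : ℤ) : |t| ≤ |t + n| := by
  rcases eq_or_ne n 0 with rfl | hn
  · simp
  · have h1 : (1 : ℝ) ≤ |(n : ℝ)| := by exact_mod_cast Int.one_le_abs hn
    have h2 := abs_sub (t + n) t
    rw [add_sub_cancel_left] at h2
    linarith

theorem torusDist_eq_sqrt {x y : ℝ × ℝ} {e₁ e₂ : ℤ} (he₁ : |e₁| ≤ 1) (he₂ : |e₂| ≤ 1)
    (h₁ : |x.1 - y.1 + e₁| ≤ 1 / 2) (h₂ : |x.2 - y.2 + e₂| ≤ 1 / 2) :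
    torusDist x y = √((x.1 - y.1 + e₁) ^ 2 + (x.2 - y.2 + e₂) ^ 2) := by
  refine IsLeast.csInf_eq ⟨⟨e₁, e₂, he₁, he₂, rfl⟩, ?_⟩
  rintro r ⟨f₁, f₂, -, -, rfl⟩
  have g₁ := abs_le_abs_add_intCast h₁ (f₁ - e₁)
  have g₂ := abs_le_abs_add_intCast h₂ (f₂ - e₂)
  push_cast at g₁ g₂
  rw [show x.1 - y.1 + e₁ + ((f₁ : ℝ) - e₁) = x.1 - y.1 + f₁ by ring, ← sq_le_sq] at g₁
  rw [show x.2 - y.2 + e₂ + ((f₂ : ℝ) - e₂) = x.2 - y.2 + f₂ by ring, ← sq_le_sq] at g₂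
  exact Real.sqrt_le_sqrt (add_le_add g₁ g₂)

theorem exists_intCast_abs_add_le {s t : ℝ} (hs : s ∈ Set.Ico (0 : ℝ) 1)
    (ht : t ∈ Set.Ico (0 : ℝ) 1) :
    ∃ e : ℤ, |e| ≤ 1 ∧ |s - t + e| ≤ 1 / 2 ∧ (s - t + e = 0 → s = t) := by
  have h := abs_sub_round (s - t)
  obtain ⟨hs0, hs1⟩ := hs
  obtain ⟨ht0, ht1⟩ := ht
  refine ⟨-round (s - t), ?_, by simpa [← sub_eq_add_neg] using h, fun h0 => ?_⟩
  · rw [abs_le] at h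
    have h1 : (round (s - t) : ℝ) < 2 := by linarith
    have h2 : (-2 : ℝ) < round (s - t) := by linarith
    have h1' : round (s - t) < 2 := by exact_mod_cast h1
    have h2' : -2 < round (s - t) := by exact_mod_cast h2
    rw [abs_le]
    omega
  · push_cast at h0
    have h1 : (round (s - t) : ℝ) < 1 := by linarith
    have h2 : (-1 : ℝ) < round (s - t) := by linarith
    have h1' : round (s - t) < 1 := by exact_mod_cast h1
    have h2' : -1 < round (s - t) := by exact_mod_cast h2
    have h3 : round (s - t) = 0 := by omega
    rw [h3] at h0
    push_cast at h0
    linarith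

theorem exists_tendsto_discSum (w : ℝ × ℝ) (h₁ : |w.1| ≤ 1 / 2) (h₂ : |w.2| ≤ 1 / 2)
    (hw : w.1 ^ 2 + w.2 ^ 2 ≠ 0) :
    ∃ L, Tendsto (discSum w) atTop (nhds L) ∧
      |L + 2 * Real.pi * Real.log √(w.1 ^ 2 + w.2 ^ 2)| ≤ 400 := by
  have hpi := Real.pi_pos
  have hpi4 := Real.pi_le_four
  set d := √(w.1 ^ 2 + w.2 ^ 2) with hd
  have hd0 : 0 < d := Real.sqrt_pos.2 (by positivity)
  have hd2 : d ^ 2 = w.1 ^ 2 + w.2 ^ 2 := Real.sq_sqrt (by positivity)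
  have hd1 : d ^ 2 ≤ 1 := by
    rw [hd2]
    nlinarith [sq_abs w.1, sq_abs w.2, abs_nonneg w.1, abs_nonneg w.2]
  obtain ⟨L, hL, htail⟩ := exists_tendsto_of_sub_div (K := 3 / d) (by positivity)
    (fun n hn => abs_discKernel_le w h₁ h₂ hw hn) (discSum_succ w)
  refine ⟨L, hL, ?_⟩
  set m := ⌊1 / d ^ 2⌋₊ with hm
  have hm1 : 1 ≤ m := Nat.one_le_floor_iff _ |>.2 ((one_le_div (by positivity)).2 hd1)
  have hm1' : (1 : ℝ) ≤ m := by exact_mod_cast hm1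
  have hmle : (m : ℝ) ≤ 1 / d ^ 2 := Nat.floor_le (by positivity)
  have hmlt : 1 / d ^ 2 < m + 1 := Nat.lt_floor_add_one _
  have a1 : |L - discSum w m| ≤ 9 := by
    refine (htail m hm1).trans ?_
    have h : 1 / d ≤ √((m : ℝ) + 1) := by
      refine Real.le_sqrt_of_sq_le ?_
      rw [div_pow, one_pow]
      exact hmlt.le
    calc 3 * (3 / d) / √((m : ℝ) + 1) ≤ 3 * (3 / d) / (1 / d) := by gcongr
      _ = 9 := by field_simp; norm_num
  have a2 : |discSum w m - discSum 0 m| ≤ 288 := by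
    refine (abs_discSum_sub_discSum_zero_le w hm1).trans ?_
    rw [← hd2]
    have h : d ^ 2 * m ≤ 1 := by
      rw [le_div_iff₀ (by positivity)] at hmle
      linarith
    have h' : Real.pi ^ 2 ≤ 16 := by nlinarith
    nlinarith [sq_nonneg Real.pi]
  have a3 := abs_discSum_zero_sub_log_le hm1
  have l1 : Real.log m ≤ -(2 * Real.log d) := by
    have h := Real.log_le_log (by positivity) hmle
    rwa [one_div, Real.log_inv, Real.log_pow, Nat.cast_ofNat] at h
  have l2 : -(2 * Real.log d) ≤ Real.log m + 1 := by
    have h := Real.log_le_log (by positivity) (hmlt.le.trans (show (m : ℝ) + 1 ≤ 2 * m by linarith))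
    rw [one_div, Real.log_inv, Real.log_pow, Nat.cast_ofNat,
      Real.log_mul (by norm_num) (by positivity)] at h
    linarith [Real.log_two_lt_d9]
  have a4 : |Real.pi * Real.log m + 2 * Real.pi * Real.log d| ≤ 4 := by
    rw [abs_le]
    constructor <;> nlinarith
  rw [abs_le] at *
  constructor <;> linarith

/-- The partial sums `-∑_{p ∈ 2πℤ², p ≠ 0, |p| ≤ N} |p|⁻² e^{ip·(x-y)}` converge,
as `N → ∞`, to a real limit `G_x(y)`, and
`F(x,y) = G_x(y) - (1/2π) ln d(x,y)` is bounded on `{x ≠ y}`. -/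
theorem green_function_bounded :
    ∃ G : (ℝ × ℝ) → (ℝ × ℝ) → ℝ, ∃ C : ℝ,
      (∀ x ∈ Torus, ∀ y ∈ Torus, x ≠ y →
        Tendsto (fun N : ℕ => latticePartialSum N (x.1 - y.1, x.2 - y.2)) atTop
          (nhds ((G x y : ℝ) : ℂ))) ∧
      (∀ x ∈ Torus, ∀ y ∈ Torus, x ≠ y →
        |G x y - (1 / (2 * Real.pi)) * Real.log (torusDist x y)| ≤ C) := by
  have hpi := Real.pi_pos
  have hpi3 := Real.pi_gt_three
  have key : ∀ x y : ℝ × ℝ, ∃ g : ℝ, x ∈ Torus → y ∈ Torus → x ≠ y →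
      Tendsto (fun N : ℕ => latticePartialSum N (x.1 - y.1, x.2 - y.2)) atTop (nhds (g : ℂ)) ∧
        |g - (1 / (2 * Real.pi)) * Real.log (torusDist x y)| ≤ 400 := by
    intro x y
    by_cases h : x ∈ Torus ∧ y ∈ Torus ∧ x ≠ y
    swap
    · exact ⟨0, fun hx hy hxy => absurd ⟨hx, hy, hxy⟩ h⟩
    obtain ⟨hx, hy, hxy⟩ := h
    obtain ⟨e₁, he₁, h₁, z₁⟩ := exists_intCast_abs_add_le hx.1 hy.1
    obtain ⟨e₂, he₂, h₂, z₂⟩ := exists_intCast_abs_add_le hx.2 hy.2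
    have hw : (x.1 - y.1 + e₁) ^ 2 + (x.2 - y.2 + e₂) ^ 2 ≠ 0 := by
      intro h0
      refine hxy (Prod.ext (z₁ ?_) (z₂ ?_)) <;>
        nlinarith [sq_nonneg (x.1 - y.1 + e₁), sq_nonneg (x.2 - y.2 + e₂)]
    obtain ⟨L, hL, hbound⟩ := exists_tendsto_discSum (x.1 - y.1 + e₁, x.2 - y.2 + e₂) h₁ h₂ hw
    refine ⟨-(1 / (4 * Real.pi ^ 2)) * L, fun _ _ _ => ⟨?_, ?_⟩⟩
    · have hfloor : Tendsto (fun N : ℕ => ⌊(N : ℝ) ^ 2 / (4 * Real.pi ^ 2)⌋₊) atTop atTop :=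
        tendsto_nat_floor_atTop.comp (Tendsto.atTop_div_const (by positivity)
          ((tendsto_pow_atTop two_ne_zero).comp tendsto_natCast_atTop_atTop))
      have hlim := (Complex.continuous_ofReal.tendsto _).comp
        ((hL.comp hfloor).const_mul (-(1 / (4 * Real.pi ^ 2))))
      refine hlim.congr fun N => ?_
      rw [latticePartialSum_eq, ← discSum_add_intCast _ e₁ e₂]
      rfl
    · rw [torusDist_eq_sqrt he₁ he₂ h₁ h₂]
      set l := Real.log √((x.1 - y.1 + e₁) ^ 2 + (x.2 - y.2 + e₂) ^ 2)
      have e : -(1 / (4 * Real.pi ^ 2)) * L - 1 / (2 * Real.pi) * l =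
          -((1 / (4 * Real.pi ^ 2)) * (L + 2 * Real.pi * l)) := by
        field_simp
        ring
      have hc : 1 / (4 * Real.pi ^ 2) ≤ 1 := by
        rw [div_le_one (by positivity)]
        nlinarith
      rw [e, abs_neg, abs_mul, abs_of_pos (by positivity)]
      calc _ ≤ 1 * (400 : ℝ) := by gcongr
        _ = 400 := one_mul _
  choose G hG using key
  exact ⟨G, 400, fun x hx y hy hxy => (hG x y hx hy hxy).1,
    fun x hx y hy hxy => (hG x y hx hy hxy).2⟩
end
end

section
/- Let τ be a nonnegative random variable and M > 0 be such that E[τ²] ≤ 2M². Then for every θ > 0, one has E[e^{−θτ}] ≤ exp(−θ·E[τ] + θ²M²). -/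
open MeasureTheory

theorem exp_neg_le_quadratic_of_nonneg {x : ℝ} (hx : 0 ≤ x) :
    Real.exp (-x) ≤ 1 - x + x ^ 2 / 2 := by
  have hpos : 0 ≤ 1 - x + x ^ 2 / 2 := by nlinarith [sq_nonneg (x - 1)]
  have hmul := mul_le_mul_of_nonneg_left (Real.quadratic_le_exp_of_nonneg hx) hpos
  rw [Real.exp_neg, inv_le_iff_one_le_mul₀ (Real.exp_pos x)]
  nlinarith [sq_nonneg (x ^ 2)]

/-- Exponential moment lower-tail bound: if `τ ≥ 0` has `E[τ²] ≤ 2M²`, then for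
every `θ > 0`, `E[e^{-θτ}] ≤ exp(-θ E[τ] + θ² M²)`. -/
theorem exp_moment_lower {Ω : Type*} [MeasurableSpace Ω] (P : Measure Ω)
    [IsProbabilityMeasure P] (τ : Ω → ℝ) (hmeas : Measurable τ)
    (hnonneg : ∀ ω, 0 ≤ τ ω) (M : ℝ) (hM : 0 < M)
    (hint1 : Integrable τ P) (hint2 : Integrable (fun ω => τ ω ^ 2) P)
    (hmom : ∫ ω, τ ω ^ 2 ∂P ≤ 2 * M ^ 2) (θ : ℝ) (hθ : 0 < θ) :
    ∫ ω, Real.exp (-θ * τ ω) ∂P ≤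
      Real.exp (-θ * ∫ ω, τ ω ∂P + θ ^ 2 * M ^ 2) := by
  have hlin : Integrable (fun ω => 1 - θ * τ ω) P :=
    (integrable_const 1).sub (hint1.const_mul θ)
  have hsq : Integrable (fun ω => θ ^ 2 / 2 * τ ω ^ 2) P := hint2.const_mul _
  have hexp : Integrable (fun ω => Real.exp (-θ * τ ω)) P := by
    refine (integrable_const (1 : ℝ)).mono' (by fun_prop) (ae_of_all _ fun ω => ?_)
    rw [Real.norm_eq_abs, Real.abs_exp, Real.exp_le_one_iff]
    nlinarith [mul_nonneg hθ.le (hnonneg ω)]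
  calc ∫ ω, Real.exp (-θ * τ ω) ∂P
      ≤ ∫ ω, ((1 - θ * τ ω) + θ ^ 2 / 2 * τ ω ^ 2) ∂P := by
        refine integral_mono hexp (hlin.add hsq) fun ω => ?_
        have h := exp_neg_le_quadratic_of_nonneg (mul_nonneg hθ.le (hnonneg ω))
        rw [← neg_mul] at h
        exact h.trans_eq (by ring)
    _ = 1 - θ * ∫ ω, τ ω ∂P + θ ^ 2 / 2 * ∫ ω, τ ω ^ 2 ∂P := by
        rw [integral_add hlin hsq, integral_sub (integrable_const 1) (hint1.const_mul θ),
          integral_const_mul, integral_const_mul]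
        simp
    _ ≤ (-θ * ∫ ω, τ ω ∂P + θ ^ 2 * M ^ 2) + 1 := by
        have h := mul_le_mul_of_nonneg_left hmom (by positivity : 0 ≤ θ ^ 2 / 2)
        linarith
    _ ≤ Real.exp (-θ * ∫ ω, τ ω ∂P + θ ^ 2 * M ^ 2) := Real.add_one_le_exp _
end
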